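/- arXiv:1011.1773 — 13 statements merged into one kernel-verified Lean document; each statement's English description precedes it below -/
import Mathlib

section
/- Let a, b, c be real numbers with 0 < a < b < 1, a + b ≤ 1, and c > 1. Then the sequence n ↦ (c − a^n)/(c − b^n) is strictly decreasing in n ≥ 1; that is, for every integer n ≥ 1, (c − a^(n+1))/(c − b^(n+1)) < (c − a^n)/(c − b^n). -/
theorem stmt_1 (a b c : ℝ) (ha : 0 < a) (hab : a < b) (hb : b < 1)
    (hab1 : a + b ≤ 1) (hc : 1 < c) (n : ℕ) (hn : 1 ≤ n) :
    (c - a ^ (n + 1)) / (c - b ^ (n + 1)) < (c - a ^ n) / (c - b ^ n) := by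
  have hb0 : 0 < b := ha.trans hab
  have key : a ^ n * (1 - a) ≤ b ^ n * (1 - b) := by
    induction n, hn using Nat.le_induction with
    | base => nlinarith
    | succ k hk ih =>
      have h0 : 0 ≤ a ^ k * (1 - a) := mul_nonneg (by positivity) (by linarith)
      have h1 := mul_le_mul hab.le ih h0 hb0.le
      calc a ^ (k + 1) * (1 - a) = a * (a ^ k * (1 - a)) := by ring
        _ ≤ b * (b ^ k * (1 - b)) := h1
        _ = b ^ (k + 1) * (1 - b) := by ring
  have h1 : b ^ n ≤ 1 := pow_le_one₀ hb0.le hb.le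
  have h2 : b ^ (n + 1) ≤ 1 := pow_le_one₀ hb0.le hb.le
  rw [div_lt_div_iff₀ (by linarith) (by linarith)]
  have h3 : 0 < (b - a) * (a ^ n * b ^ n) := mul_pos (by linarith) (by positivity)
  have h4 : 0 ≤ c * (b ^ n * (1 - b) - a ^ n * (1 - a)) :=
    mul_nonneg (by linarith) (by linarith)
  rw [pow_succ, pow_succ]
  linarith
end

section
/- Let c be a real number with 0 < c ≤ 1/2 and let n ≥ 1 be an integer. Then the functions f(x) := (x − c·x^n)/(1 − c·x^n) and g(x) := (x − c·x^n)/(1 − c·x^(n+1)) are strictly increasing on the open interval (0,1). -/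
theorem auxA (x y : ℝ) (hx : 0 < x) (hxy : x < y) (hy : y < 1) (n : ℕ) :
    (1 - x) * (y ^ n - x ^ n) ≤ (y - x) * (1 - x ^ n) := by
  induction n with
  | zero => simp
  | succ k ih =>
    have h1 := mul_le_mul_of_nonneg_left ih (by linarith : 0 ≤ y)
    have h2 : x ^ k ≤ 1 := pow_le_one₀ hx.le (by linarith)
    have h3 : 0 ≤ (1 - y) * ((y - x) * (1 - x ^ k)) :=
      mul_nonneg (by linarith) (mul_nonneg (by linarith) (by linarith))
    rw [pow_succ, pow_succ]
    linear_combination h1 + h3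

theorem auxB (x y : ℝ) (hx : 0 < x) (hxy : x < y) (hy : y < 1) (n : ℕ) :
    (1 - y) * (y ^ n - x ^ n) ≤ (y - x) * (1 - y ^ n) := by
  induction n with
  | zero => simp
  | succ k ih =>
    have h1 := mul_le_mul_of_nonneg_left ih hx.le
    have h2 : y ^ k ≤ 1 := pow_le_one₀ (by linarith) (by linarith)
    have h3 : 0 ≤ (1 - x) * ((y - x) * (1 - y ^ k)) :=
      mul_nonneg (by linarith) (mul_nonneg (by linarith) (by linarith))
    rw [pow_succ, pow_succ]
    linear_combination h1 + h3

theorem stmt_2 (c : ℝ) (hc0 : 0 < c) (hc : c ≤ 1 / 2) (n : ℕ) (hn : 1 ≤ n) :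
    StrictMonoOn (fun x : ℝ => (x - c * x ^ n) / (1 - c * x ^ n)) (Set.Ioo 0 1) ∧
    StrictMonoOn (fun x : ℝ => (x - c * x ^ n) / (1 - c * x ^ (n + 1))) (Set.Ioo 0 1) := by
  have den : ∀ m : ℕ, ∀ x : ℝ, 0 < x → x < 1 → 0 < 1 - c * x ^ m := by
    intro m x h0 h1
    have := pow_le_one₀ (n := m) h0.le h1.le
    have := pow_pos h0 m
    nlinarith
  constructor
  · rintro x ⟨hx, hx1⟩ y ⟨hy, hy1⟩ hxy
    have hA := mul_le_mul_of_nonneg_left (auxA x y hx hxy hy1 n) hc0.le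
    have h : 0 < (y - x) * (1 - c) := mul_pos (by linarith) (by linarith)
    show _ / _ < _ / _
    rw [div_lt_div_iff₀ (den n x hx hx1) (den n y hy hy1)]
    linear_combination hA + h
  · rintro x ⟨hx, hx1⟩ y ⟨hy, hy1⟩ hxy
    have hA := mul_le_mul_of_nonneg_left (auxA x y hx hxy hy1 n) hc0.le
    have hB := mul_le_mul_of_nonneg_left (auxB x y hx hxy hy1 n) (mul_pos hc0 hx).le
    have hp := pow_pos hx n
    have hq := pow_pos hy n
    have hp1 : x ^ n ≤ 1 := pow_le_one₀ hx.le hx1.le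
    have hq1 : y ^ n ≤ 1 := pow_le_one₀ hy.le hy1.le
    have key : 0 < 1 - c ^ 2 * (x ^ n * y ^ n) - c * (1 - x ^ n + x * (1 - y ^ n)) := by
      have e1 : 0 < 1 - c * (1 + x) := by nlinarith
      have e2 : 0 ≤ c * x ^ n * (1 - c * y ^ n) :=
        mul_nonneg (mul_pos hc0 hp).le (den n y hy hy1).le
      have e3 : 0 < c * x * y ^ n := by positivity
      linear_combination e1 + e2 + e3
    have h := mul_pos (sub_pos.2 hxy) key
    show _ / _ < _ / _
    rw [div_lt_div_iff₀ (den _ x hx hx1) (den _ y hy hy1), pow_succ, pow_succ]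
    linear_combination hA + hB + h
end

section
/- For every real ρ with 0 < ρ < 1, the numbers e₁° := −1/2 + (1−ρ)S/(2(1+ρ)(1+ρ²)) and e₂° := −1/2 − (1−ρ)S/(2(1+ρ)(1+ρ²)) satisfy −1 < e₂° < −1/2 < e₁° < 0, and consequently φ₁ := 1/(1 − e₂°) and φ₂ := 1/(1 − e₁°) satisfy 1/2 < φ₁ < 2/3 < φ₂ < 1. -/
theorem stmt_3 (ρ : ℝ) (hρ0 : 0 < ρ) (hρ1 : ρ < 1) :
    let S : ℝ := Real.sqrt ((1 + ρ ^ 2) * (1 + 4 * ρ + ρ ^ 2))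
    let e1 : ℝ := -(1 / 2) + (1 - ρ) * S / (2 * (1 + ρ) * (1 + ρ ^ 2))
    let e2 : ℝ := -(1 / 2) - (1 - ρ) * S / (2 * (1 + ρ) * (1 + ρ ^ 2))
    (-1 : ℝ) < e2 ∧ e2 < -(1 / 2) ∧ -(1 / 2) < e1 ∧ e1 < 0 ∧
    1 / 2 < 1 / (1 - e2) ∧ 1 / (1 - e2) < 2 / 3 ∧
    2 / 3 < 1 / (1 - e1) ∧ 1 / (1 - e1) < 1 := by
  intro S e1 e2
  have hS : 0 < S := Real.sqrt_pos.mpr (by positivity)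
  have hS2 : S ^ 2 = (1 + ρ ^ 2) * (1 + 4 * ρ + ρ ^ 2) := Real.sq_sqrt (by positivity)
  have h1 : 0 < 1 - ρ := by linarith
  have hlt : (1 - ρ) * S < (1 + ρ) * (1 + ρ ^ 2) := by
    apply lt_of_pow_lt_pow_left₀ 2 (by positivity)
    rw [mul_pow, hS2]
    have : 0 < 8 * ρ ^ 2 * (1 + ρ ^ 2) := by positivity
    linarith [show ((1 + ρ) * (1 + ρ ^ 2)) ^ 2
      - (1 - ρ) ^ 2 * ((1 + ρ ^ 2) * (1 + 4 * ρ + ρ ^ 2)) = 8 * ρ ^ 2 * (1 + ρ ^ 2) by ring]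
  obtain ⟨t, ht⟩ : ∃ t, t = (1 - ρ) * S / (2 * (1 + ρ) * (1 + ρ ^ 2)) := ⟨_, rfl⟩
  have ht0 : 0 < t := by rw [ht]; positivity
  have ht1 : t < 1 / 2 := by
    rw [ht, div_lt_iff₀ (by positivity)]
    linarith
  have he1 : e1 = -(1 / 2) + t := by rw [ht]
  have he2 : e2 = -(1 / 2) - t := by rw [ht]
  rw [he1, he2]
  refine ⟨by linarith, by linarith, by linarith, by linarith, ?_, ?_, ?_, ?_⟩
  · rw [lt_div_iff₀ (by linarith)]; linarith
  · rw [div_lt_iff₀ (by linarith)]; linarith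
  · rw [lt_div_iff₀ (by linarith)]; linarith
  · rw [div_lt_iff₀ (by linarith)]; linarith
end

section
/- For every x = (x₀, x₁, x₂) ∈ Δ with x₀ ≥ π₀, there exists an integer n ≥ 1 such that the first coordinate of x·P_A^n is strictly less than π₀. (That is, under the greedy strategy, game A is chosen for only finitely many consecutive turns from any initial state in Δ_A.) -/
open Matrix Filter

/-- Game A's one-step transition matrix (fully mixing). -/
noncomputable def PAo : Matrix (Fin 3) (Fin 3) ℝ :=
  !![0, 1/2, 1/2; 1/2, 0, 1/2; 1/2, 1/2, 0]

/-- Game B's one-step transition matrix. -/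
noncomputable def PBo (ρ : ℝ) : Matrix (Fin 3) (Fin 3) ℝ :=
  !![0, ρ^2/(1+ρ^2), 1 - ρ^2/(1+ρ^2);
     1 - 1/(1+ρ), 0, 1/(1+ρ);
     1/(1+ρ), 1 - 1/(1+ρ), 0]

/-- Transition matrix when a fraction φ of the players plays game A. -/
noncomputable def PA (φ : ℝ) : Matrix (Fin 3) (Fin 3) ℝ :=
  (1 - φ) • (1 : Matrix (Fin 3) (Fin 3) ℝ) + φ • PAo

/-- Transition matrix when a fraction φ of the players plays game B. -/
noncomputable def PB (ρ φ : ℝ) : Matrix (Fin 3) (Fin 3) ℝ :=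
  (1 - φ) • (1 : Matrix (Fin 3) (Fin 3) ℝ) + φ • PBo ρ

/-- The simplex of probability row vectors in ℝ³. -/
def Δ : Set (Fin 3 → ℝ) := {x | (∀ i, 0 ≤ x i) ∧ x 0 + x 1 + x 2 = 1}

noncomputable def pi0 (ρ : ℝ) : ℝ := (1 + ρ^2) / (2 * (1 + ρ + ρ^2))
noncomputable def pi1 (ρ : ℝ) : ℝ := ρ * (1 + ρ) / (2 * (1 + ρ + ρ^2))
noncomputable def pi2 (ρ : ℝ) : ℝ := (1 + ρ) / (2 * (1 + ρ + ρ^2))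

noncomputable def Sv (ρ : ℝ) : ℝ := Real.sqrt ((1 + ρ^2) * (1 + 4*ρ + ρ^2))

noncomputable def e1 (ρ φ : ℝ) : ℝ :=
  1 - φ + φ * (-(1/2) + (1 - ρ) * Sv ρ / (2 * (1 + ρ) * (1 + ρ^2)))

noncomputable def e2 (ρ φ : ℝ) : ℝ :=
  1 - φ + φ * (-(1/2) - (1 - ρ) * Sv ρ / (2 * (1 + ρ) * (1 + ρ^2)))

/-- `Emn ρ φ n m` is the quantity `E_{n,m}`; `E_n = Emn ρ φ n n`. -/
noncomputable def Emn (ρ φ : ℝ) (n m : ℕ) : ℝ :=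
  φ * (1 - ρ) / 2 *
    ((e2 ρ φ)^m * (2 + (e1 ρ φ)^n * (3*φ - 2)) * (3*(1+ρ)*(1+ρ^2) - (1-ρ) * Sv ρ)
      - (e1 ρ φ)^m * (2 + (e2 ρ φ)^n * (3*φ - 2)) * (3*(1+ρ)*(1+ρ^2) + (1-ρ) * Sv ρ))

/-- `Dn ρ φ n` is the quantity `D_n`. -/
noncomputable def Dn (ρ φ : ℝ) (n : ℕ) : ℝ :=
  2 * (2 + (e1 ρ φ)^n * (3*φ - 2)) * (2 + (e2 ρ φ)^n * (3*φ - 2)) * (1 + ρ + ρ^2) * Sv ρ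

/-- `Gmn ρ φ n m` is the quantity `G_{n,m}`. -/
noncomputable def Gmn (ρ φ : ℝ) (n m : ℕ) : ℝ :=
  φ * (1 - ρ) *
    ((e2 ρ φ)^m * (4 - (e1 ρ φ)^(2*(n-1)) * (3*φ - 2)^2) * (2 - (e2 ρ φ)^(n-2) * (3*φ - 2))
        * (3*(1+ρ)*(1+ρ^2) - (1-ρ) * Sv ρ)
      - (e1 ρ φ)^m * (4 - (e2 ρ φ)^(2*(n-1)) * (3*φ - 2)^2) * (2 - (e1 ρ φ)^(n-2) * (3*φ - 2))
        * (3*(1+ρ)*(1+ρ^2) + (1-ρ) * Sv ρ))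

/-- `Hmn ρ φ n m` is the quantity `H_{n,m}`. -/
noncomputable def Hmn (ρ φ : ℝ) (n m : ℕ) : ℝ :=
  φ * (1 - ρ) *
    ((e2 ρ φ)^m * (4 - (e1 ρ φ)^(2*(n-1)) * (3*φ - 2)^2) * (2 - (e2 ρ φ)^n * (3*φ - 2))
        * (3*(1+ρ)*(1+ρ^2) - (1-ρ) * Sv ρ)
      - (e1 ρ φ)^m * (4 - (e2 ρ φ)^(2*(n-1)) * (3*φ - 2)^2) * (2 - (e1 ρ φ)^n * (3*φ - 2))
        * (3*(1+ρ)*(1+ρ^2) + (1-ρ) * Sv ρ))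

lemma PA_iter (φ : ℝ) (x : Fin 3 → ℝ) (hx : x 0 + x 1 + x 2 = 1) (n : ℕ) :
    ((x ᵥ* ((PA φ) ^ n)) 0 + (x ᵥ* ((PA φ) ^ n)) 1 + (x ᵥ* ((PA φ) ^ n)) 2 = 1) ∧
    (x ᵥ* ((PA φ) ^ n)) 0 = 1/3 + (1 - 3*φ/2)^n * (x 0 - 1/3) := by
  induction n with
  | zero => simp [hx]
  | succ n ih =>
    obtain ⟨h1, h2⟩ := ih
    rw [pow_succ, ← Matrix.vecMul_vecMul]
    set y := x ᵥ* ((PA φ) ^ n) with hy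
    have g0 : (y ᵥ* PA φ) 0 = (1 - φ) * y 0 + φ/2 * (y 1 + y 2) := by
      simp [PA, PAo, Matrix.vecMul, dotProduct, Fin.sum_univ_three, Matrix.one_apply]
      ring
    have g1 : (y ᵥ* PA φ) 1 = (1 - φ) * y 1 + φ/2 * (y 0 + y 2) := by
      simp [PA, PAo, Matrix.vecMul, dotProduct, Fin.sum_univ_three, Matrix.one_apply]
      ring
    have g2 : (y ᵥ* PA φ) 2 = (1 - φ) * y 2 + φ/2 * (y 0 + y 1) := by
      simp [PA, PAo, Matrix.vecMul, dotProduct, Fin.sum_univ_three, Matrix.one_apply]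
      ring
    rw [g0, g1, g2]
    refine ⟨by linear_combination h1, ?_⟩
    rw [pow_succ]
    linear_combination (1 - 3*φ/2) * h2 + φ/2 * h1

theorem stmt_4 (ρ φ : ℝ) (hρ0 : 0 < ρ) (hρ1 : ρ < 1) (hφ0 : 0 < φ) (hφ1 : φ ≤ 1)
    (x : Fin 3 → ℝ) (hx : x ∈ Δ) (hx0 : pi0 ρ ≤ x 0) :
    ∃ n : ℕ, 1 ≤ n ∧ (x ᵥ* ((PA φ) ^ n)) 0 < pi0 ρ := by
  have key : ∀ n : ℕ, (x ᵥ* ((PA φ) ^ n)) 0 = 1/3 + (1 - 3*φ/2)^n * (x 0 - 1/3) :=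
    fun n => (PA_iter φ x hx.2 n).2
  have hp : 0 < pi0 ρ - 1/3 := by
    have e : pi0 ρ - 1/3 = (1 - ρ)^2 / (6 * (1 + ρ + ρ^2)) := by
      have : 1 + ρ + ρ^2 ≠ 0 := by positivity
      unfold pi0
      field_simp
      ring
    rw [e]
    have : 0 < 1 - ρ := by linarith
    positivity
  have ht : Tendsto (fun n : ℕ => (1 - 3*φ/2)^n * (x 0 - 1/3)) atTop (nhds 0) := by
    have := (tendsto_pow_atTop_nhds_zero_of_abs_lt_one
      (r := 1 - 3*φ/2) (by rw [abs_lt]; constructor <;> linarith)).mul_const (x 0 - 1/3)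
    simpa using this
  obtain ⟨n, hn, h1⟩ := ((ht.eventually (gt_mem_nhds hp)).and (eventually_ge_atTop 1)).exists
  exact ⟨n, h1, by rw [key]; linarith⟩
end

section
/- Assume 2/3 ≤ φ ≤ 1. Then for every x = (x₀, x₁, x₂) ∈ Δ with x₀ ≥ π₀, the first coordinate of x·P_A satisfies (x·P_A)₀ ≤ 1/3 < π₀. (That is, after only one play of game A, game B is played.) -/
open Matrix Filter

theorem stmt_5 (ρ φ : ℝ) (hρ0 : 0 < ρ) (hρ1 : ρ < 1) (hφ0 : 2/3 ≤ φ) (hφ1 : φ ≤ 1)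
    (x : Fin 3 → ℝ) (hx : x ∈ Δ) (hx0 : pi0 ρ ≤ x 0) :
    (x ᵥ* PA φ) 0 ≤ 1/3 ∧ (1/3 : ℝ) < pi0 ρ := by
  have hpi : (1/3 : ℝ) < pi0 ρ := by
    unfold pi0
    rw [lt_div_iff₀ (by positivity)]
    nlinarith [mul_pos (sub_pos.mpr hρ1) (sub_pos.mpr hρ1)]
  refine ⟨?_, hpi⟩
  have hsum : x 0 + x 1 + x 2 = 1 := hx.2
  have hval : (x ᵥ* PA φ) 0 = (1 - φ) * x 0 + φ / 2 * (x 1 + x 2) := by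
    simp [PA, PAo, Matrix.vecMul, dotProduct, Fin.sum_univ_three]
    ring
  have h12 : x 1 + x 2 = 1 - x 0 := by linarith
  rw [hval, h12]
  nlinarith [mul_nonneg (sub_nonneg.mpr hφ0) (sub_nonneg.mpr (hpi.le.trans hx0))]
end

section
/- For every x = (x₀, x₁, x₂) ∈ Δ and every integer n ≥ 0, π₀ − (x·P_B^n)₀ = c₁·e₁^n − c₂·e₂^n, where c₁ := ((1+ρ²)/(2S))·[(1 − S/(1+ρ²))(x₀ − π₀) + 2(x₁ − π₁)] and c₂ := ((1+ρ²)/(2S))·[(1 + S/(1+ρ²))(x₀ − π₀) + 2(x₁ − π₁)]. -/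
open Matrix Filter

theorem step_coords (ρ φ : ℝ) (x : Fin 3 → ℝ) :
    (x ᵥ* PB ρ φ) 0 = (1 - φ) * x 0 + φ * (x 1 * (1 - 1/(1+ρ)) + x 2 * (1/(1+ρ))) ∧
    (x ᵥ* PB ρ φ) 1 = (1 - φ) * x 1 + φ * (x 0 * (ρ^2/(1+ρ^2)) + x 2 * (1 - 1/(1+ρ))) ∧
    (x ᵥ* PB ρ φ) 2 = (1 - φ) * x 2 + φ * (x 0 * (1 - ρ^2/(1+ρ^2)) + x 1 * (1/(1+ρ))) := by
  refine ⟨?_, ?_, ?_⟩ <;>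
  · simp [PB, PBo, Matrix.vecMul, dotProduct, Fin.sum_univ_three, Matrix.one_apply]
    ring

theorem eig_step (ρ φ s : ℝ) (hρ0 : 0 < ρ) (hs : s^2 = (1 + ρ^2) * (1 + 4*ρ + ρ^2))
    (x : Fin 3 → ℝ) (hx : x 0 + x 1 + x 2 = 1) :
    (1 - s / (1 + ρ^2)) * ((x ᵥ* PB ρ φ) 0 - pi0 ρ) + 2 * ((x ᵥ* PB ρ φ) 1 - pi1 ρ) =
    (1 - φ + φ * (-(1/2) + (1 - ρ) * s / (2 * (1 + ρ) * (1 + ρ^2)))) *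
      ((1 - s / (1 + ρ^2)) * (x 0 - pi0 ρ) + 2 * (x 1 - pi1 ρ)) := by
  obtain ⟨h0, h1, -⟩ := step_coords ρ φ x
  have hx2 : x 2 = 1 - x 0 - x 1 := by linarith
  rw [h0, h1, hx2, pi0, pi1]
  have ha : 1 + ρ^2 ≠ 0 := by positivity
  have hb : 1 + ρ ≠ 0 := by positivity
  have hc : 1 + ρ + ρ^2 ≠ 0 := by positivity
  obtain ⟨r, rfl⟩ : ∃ r, s = r * (1 + ρ^2) := ⟨s / (1+ρ^2), by field_simp⟩
  have hr : r^2 * (1 + ρ^2) = 1 + 4*ρ + ρ^2 := by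
    apply mul_left_cancel₀ ha
    linear_combination hs
  generalize x 0 = u
  generalize x 1 = v
  have e : r * (1 + ρ^2) / (1 + ρ^2) = r := by field_simp
  have e' : (1 - ρ) * (r * (1 + ρ^2)) / (2 * (1 + ρ) * (1 + ρ^2)) = (1 - ρ) * r / (2 * (1+ρ)) := by
    field_simp
  have hr2 : r^2 = (1 + 4*ρ + ρ^2) / (1 + ρ^2) := by rw [eq_div_iff ha]; exact hr
  rw [e, e']
  have key : (1 - ρ) * φ / (2 * (1 + ρ)) * (u - (1 + ρ^2) / (2 * (1 + ρ + ρ^2))) *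
      (r^2 - (1 + 4*ρ + ρ^2) / (1 + ρ^2)) = 0 := by rw [hr2]; ring
  rw [← sub_eq_zero, ← key]
  field_simp
  ring

theorem stmt_6 (ρ φ : ℝ) (hρ0 : 0 < ρ) (hρ1 : ρ < 1) (hφ0 : 0 < φ) (hφ1 : φ ≤ 1)
    (x : Fin 3 → ℝ) (hx : x ∈ Δ) (n : ℕ) :
    pi0 ρ - (x ᵥ* ((PB ρ φ) ^ n)) 0 =
      (1 + ρ^2) / (2 * Sv ρ) *
          ((1 - Sv ρ / (1 + ρ^2)) * (x 0 - pi0 ρ) + 2 * (x 1 - pi1 ρ)) * (e1 ρ φ)^n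
        - (1 + ρ^2) / (2 * Sv ρ) *
          ((1 + Sv ρ / (1 + ρ^2)) * (x 0 - pi0 ρ) + 2 * (x 1 - pi1 ρ)) * (e2 ρ φ)^n := by
  have hS : 0 < Sv ρ := by
    unfold Sv
    positivity
  have hS2 : Sv ρ ^ 2 = (1 + ρ^2) * (1 + 4*ρ + ρ^2) := Real.sq_sqrt (by positivity)
  have ha : 1 + ρ^2 ≠ 0 := by positivity
  obtain ⟨-, hx⟩ := hx
  induction n generalizing x with
  | zero =>
    simp only [pow_zero, Matrix.vecMul_one]
    have := hS.ne'
    field_simp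
    ring
  | succ n ih =>
    rw [pow_succ' (PB ρ φ), ← Matrix.vecMul_vecMul, ih]
    · have h1 := eig_step ρ φ (Sv ρ) hρ0 hS2 x hx
      have h2 := eig_step ρ φ (-Sv ρ) hρ0 (by rw [neg_sq, hS2]) x hx
      simp only [neg_div, mul_neg, sub_neg_eq_add, ← sub_eq_add_neg] at h2
      rw [h1, h2, ← e1, ← e2]
      ring
    · obtain ⟨h0, h1, h2⟩ := step_coords ρ φ x
      rw [h0, h1, h2]
      linear_combination hx
end

section
/- Assume 0 < φ ≤ 2/3 and define the greedy map F : Δ → Δ by F(x) := x·P_A if x₀ ≥ π₀ and F(x) := x·P_B if x₀ < π₀. Then for every x ∈ Δ: (i) there exists an integer N ≥ 0 such that for all n ≥ N the first coordinate of F^n(x) is strictly less than π₀ (so game B is played forever after finitely many turns); and (ii) F^n(x) converges, as n → ∞, to π := (π₀, π₁, π₂) with π₂ := (1+ρ)/(2(1+ρ+ρ²)). In particular, π is a globally asymptotically stable equilibrium of the system. -/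
open Matrix Filter

lemma seq_aux (r s w v b g θ : ℝ) (hr : 0 ≤ r) (hrs : s = 1 - r) (hs : 0 < s) (hw : w < 0)
    (hv : 0 < v) (hb : 0 < b) (hg : 0 < g) (hθ : θ < 1) (h1 : r + g / 2 ≤ θ) (h2 : r + 2 * b ≤ θ)
    (Y Z : ℕ → ℝ)
    (hA : ∀ n, 0 ≤ Y n → Y (n+1) = r * Y n + s * w ∧ Z (n+1) = r * Z n + s * v)
    (hB : ∀ n, Y n < 0 → Y (n+1) = r * Y n - b * Z n ∧ Z (n+1) = r * Z n - g * Y n) :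
    (∃ N : ℕ, ∀ n, N ≤ n → Y n < 0) ∧ Tendsto Y atTop (nhds 0) ∧ Tendsto Z atTop (nhds 0) := by
  have hsw : s * w < 0 := mul_neg_of_pos_of_neg hs hw
  have hsv : 0 < s * v := mul_pos hs hv
  have key : ∃ N : ℕ, ∀ n, N ≤ n → Y n < 0 := by
    by_cases hc : ∃ N, 0 < Z N
    · obtain ⟨N, hN⟩ := hc
      have hZ : ∀ n, N ≤ n → 0 < Z n := by
        intro n hn
        induction n, hn using Nat.le_induction with
        | base => exact hN
        | succ n hn ih =>
          rcases le_or_gt 0 (Y n) with h | h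
          · rw [(hA n h).2]
            have := mul_nonneg hr ih.le
            linarith
          · rw [(hB n h).2]
            have := mul_nonneg hr ih.le
            have := mul_neg_of_pos_of_neg hg h
            linarith
      have hex : ∃ M, N ≤ M ∧ Y M < 0 := by
        by_contra! hcon
        have hstep : ∀ m : ℕ, Y (N + m) ≤ Y N + m * (s * w) := by
          intro m
          induction m with
          | zero => simp
          | succ m ih =>
            have hp := hcon (N + m) (by omega)
            have := (hA _ hp).1
            rw [← add_assoc, this]
            push_cast
            have : r * Y (N + m) ≤ Y (N + m) := by nlinarith
            linarith
        obtain ⟨m, hm⟩ := exists_nat_gt (Y N / (-(s * w)))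
        rw [div_lt_iff₀ (by linarith)] at hm
        have := hstep m
        have := hcon (N + m) (by omega)
        linarith
      obtain ⟨M, hNM, hM⟩ := hex
      refine ⟨M, fun n hn => ?_⟩
      induction n, hn using Nat.le_induction with
      | base => exact hM
      | succ n hn ih =>
        rw [(hB n ih).1]
        have := mul_nonneg hr (neg_nonneg.2 ih.le)
        have := mul_pos hb (hZ n (by omega))
        linarith
    · push Not at hc
      by_contra! hcon
      have hmono : Monotone Z := by
        refine monotone_nat_of_le_succ fun n => ?_
        have hz := hc n
        have : Z n ≤ r * Z n := by nlinarith
        rcases le_or_gt 0 (Y n) with h | h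
        · rw [(hA n h).2]; linarith
        · rw [(hB n h).2]
          have := mul_neg_of_pos_of_neg hg h
          linarith
      have hstep : ∀ m : ℕ, ∃ n, Z 0 + m * (s * v) ≤ Z n := by
        intro m
        induction m with
        | zero => exact ⟨0, by simp⟩
        | succ m ih =>
          obtain ⟨n, hn⟩ := ih
          obtain ⟨k, hk, hY⟩ := hcon n
          refine ⟨k + 1, ?_⟩
          rw [(hA k hY).2]
          have hz := hc k
          have : Z k ≤ r * Z k := by nlinarith
          have := hmono hk
          push_cast
          linarith
      obtain ⟨m, hm⟩ := exists_nat_gt ((-Z 0) / (s * v))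
      rw [div_lt_iff₀ hsv] at hm
      obtain ⟨n, hn⟩ := hstep m
      have := hc n
      linarith
  refine ⟨key, ?_⟩
  obtain ⟨N, hN⟩ := key
  have hθ0 : 0 ≤ θ := by linarith
  have hbd : ∀ m : ℕ, |Y (m + N)| + |Z (m + N)| / 2 ≤ θ ^ m * (|Y N| + |Z N| / 2) := by
    intro m
    induction m with
    | zero => simp
    | succ m ih =>
      obtain ⟨e1, e2⟩ := hB (m + N) (hN _ (by omega))
      have : m + 1 + N = m + N + 1 := by ring
      rw [this, e1, e2]
      have t1 : |r * Y (m + N) - b * Z (m + N)| ≤ r * |Y (m+N)| + b * |Z (m+N)| := by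
        refine (abs_sub _ _).trans ?_
        rw [abs_mul, abs_mul, abs_of_nonneg hr, abs_of_pos hb]
      have t2 : |r * Z (m + N) - g * Y (m + N)| ≤ r * |Z (m+N)| + g * |Y (m+N)| := by
        refine (abs_sub _ _).trans ?_
        rw [abs_mul, abs_mul, abs_of_nonneg hr, abs_of_pos hg]
      have a1 := mul_le_mul_of_nonneg_right h1 (abs_nonneg (Y (m+N)))
      have a2 := mul_le_mul_of_nonneg_right h2 (abs_nonneg (Z (m+N)))
      have a3 := mul_le_mul_of_nonneg_left ih hθ0
      rw [pow_succ]
      linarith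
  have hlim : Tendsto (fun m : ℕ => θ ^ m * (|Y N| + |Z N| / 2)) atTop (nhds 0) := by
    simpa using (tendsto_pow_atTop_nhds_zero_of_lt_one hθ0 hθ).mul_const (|Y N| + |Z N| / 2)
  have hlim2 := hlim.const_mul 2
  rw [mul_zero] at hlim2
  constructor
  · rw [← tendsto_add_atTop_iff_nat N]
    refine squeeze_zero_norm (fun m => ?_) hlim
    have := hbd m
    have := abs_nonneg (Z (m + N))
    rw [Real.norm_eq_abs]; linarith
  · rw [← tendsto_add_atTop_iff_nat N]
    refine squeeze_zero_norm (fun m => ?_) hlim2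
    have := hbd m
    have := abs_nonneg (Y (m + N))
    rw [Real.norm_eq_abs]; linarith

lemma PA_act (φ : ℝ) (x : Fin 3 → ℝ) (hx : x 0 + x 1 + x 2 = 1) :
    (x ᵥ* PA φ) 0 = (1 - 3*φ/2) * x 0 + φ/2 ∧ (x ᵥ* PA φ) 1 = (1 - 3*φ/2) * x 1 + φ/2 ∧
    (x ᵥ* PA φ) 2 = (1 - 3*φ/2) * x 2 + φ/2 := by
  have h2 : x 2 = 1 - x 0 - x 1 := by linarith
  refine ⟨?_, ?_, ?_⟩ <;>
  · simp [Matrix.vecMul, dotProduct, Fin.sum_univ_three, PA, PAo, Matrix.one_apply]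
    rw [h2]; ring

lemma PB_act (ρ φ : ℝ) (x : Fin 3 → ℝ) :
    (x ᵥ* PB ρ φ) 0 = (1-φ) * x 0 + φ * (x 1 * (1 - 1/(1+ρ)) + x 2 * (1/(1+ρ))) ∧
    (x ᵥ* PB ρ φ) 1 = (1-φ) * x 1 + φ * (x 0 * (ρ^2/(1+ρ^2)) + x 2 * (1 - 1/(1+ρ))) ∧
    (x ᵥ* PB ρ φ) 2 = (1-φ) * x 2 + φ * (x 0 * (1 - ρ^2/(1+ρ^2)) + x 1 * (1/(1+ρ))) := by
  refine ⟨?_, ?_, ?_⟩ <;>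
  · simp [Matrix.vecMul, dotProduct, Fin.sum_univ_three, PB, PBo, Matrix.one_apply]
    ring

theorem stmt_7 (ρ φ : ℝ) (hρ0 : 0 < ρ) (hρ1 : ρ < 1) (hφ0 : 0 < φ) (hφ1 : φ ≤ 2/3)
    (F : (Fin 3 → ℝ) → (Fin 3 → ℝ))
    (hF : ∀ x, F x = if pi0 ρ ≤ x 0 then x ᵥ* PA φ else x ᵥ* PB ρ φ)
    (x : Fin 3 → ℝ) (hx : x ∈ Δ) :
    (∃ N : ℕ, ∀ n : ℕ, N ≤ n → (F^[n] x) 0 < pi0 ρ) ∧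
    Tendsto (fun n : ℕ => F^[n] x) atTop (nhds ![pi0 ρ, pi1 ρ, pi2 ρ]) := by
  have p1 : (0:ℝ) < 1 + ρ := by linarith
  have p2 : (0:ℝ) < 1 + ρ^2 := by positivity
  have p3 : (0:ℝ) < 1 + ρ + ρ^2 := by positivity
  have hsum : ∀ n, (F^[n] x) 0 + (F^[n] x) 1 + (F^[n] x) 2 = 1 := by
    intro n
    induction n with
    | zero => exact hx.2
    | succ n ih =>
      rw [Function.iterate_succ_apply', hF]
      split_ifs
      · obtain ⟨a, b, c⟩ := PA_act φ (F^[n] x) ih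
        rw [a, b, c]; linear_combination (1 - 3*φ/2) * ih
      · obtain ⟨a, b, c⟩ := PB_act ρ φ (F^[n] x)
        rw [a, b, c]; linear_combination ih
  have hk0 : 0 < (1 - ρ)/(1+ρ) := div_pos (by linarith) p1
  have hk1 : (1 - ρ)/(1+ρ) < 1 := by rw [div_lt_one p1]; linarith
  have hc0 : 0 < ρ/(1+ρ) - ρ^2/(1+ρ^2) := by
    have : ρ/(1+ρ) - ρ^2/(1+ρ^2) = ρ * (1 - ρ) / ((1+ρ)*(1+ρ^2)) := by field_simp; ring
    rw [this]
    exact div_pos (mul_pos hρ0 (by linarith)) (mul_pos p1 p2)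
  have hc1 : ρ/(1+ρ) - ρ^2/(1+ρ^2) ≤ 1/2 := by
    have h : ρ/(1+ρ) ≤ 1/2 := by rw [div_le_iff₀ p1]; linarith
    have : 0 ≤ ρ^2/(1+ρ^2) := by positivity
    linarith
  set k := (1 - ρ)/(1+ρ) with hk
  set c := ρ/(1+ρ) - ρ^2/(1+ρ^2) with hc
  have hw : 1/3 - pi0 ρ < 0 := by
    have : 1/3 - pi0 ρ = -((1-ρ)^2 / (6 * (1 + ρ + ρ^2))) := by
      unfold pi0; field_simp; ring
    rw [this, neg_lt_zero]
    exact div_pos (pow_pos (by linarith) 2) (by positivity)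
  have hv : 0 < pi2 ρ - pi1 ρ := by
    have : pi2 ρ - pi1 ρ = (1+ρ)*(1-ρ) / (2 * (1 + ρ + ρ^2)) := by
      unfold pi1 pi2; field_simp
    rw [this]
    exact div_pos (mul_pos p1 (by linarith)) (by positivity)
  have main := seq_aux (1 - 3*φ/2) (3*φ/2) (1/3 - pi0 ρ) (pi2 ρ - pi1 ρ) (φ * k / 2)
    (φ * (k/2 + 2*c)) (1 - φ/4) (by linarith) (by ring) (by linarith) hw hv (by positivity)
    (by positivity) (by linarith) (by nlinarith) (by nlinarith)
    (fun n => (F^[n] x) 0 - pi0 ρ) (fun n => (F^[n] x) 1 - (F^[n] x) 2 - (pi1 ρ - pi2 ρ))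
    (by
      intro n hn
      obtain ⟨a, b, c⟩ := PA_act φ (F^[n] x) (hsum n)
      simp only [Function.iterate_succ_apply']
      rw [hF, if_pos (by linarith [hn]), a, b, c]
      constructor <;> ring)
    (by
      intro n hn
      have h2 : (F^[n] x) 2 = 1 - (F^[n] x) 0 - (F^[n] x) 1 := by linarith [hsum n]
      obtain ⟨a, b, c⟩ := PB_act ρ φ (F^[n] x)
      simp only [Function.iterate_succ_apply']
      rw [hF, if_neg (by linarith [hn]), a, b, c, h2, hk, hc]
      unfold pi0 pi1 pi2
      constructor <;>
      · field_simp
        ring)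
  obtain ⟨⟨N, hN⟩, hY, hZ⟩ := main
  refine ⟨⟨N, fun n hn => by linarith [hN n hn]⟩, ?_⟩
  have hps : pi0 ρ + pi1 ρ + pi2 ρ = 1 := by
    unfold pi0 pi1 pi2; field_simp; ring
  rw [tendsto_pi_nhds]
  intro i
  fin_cases i
  · have := hY.add_const (pi0 ρ)
    simpa using this
  · have := ((hZ.sub hY).div_const 2).add_const (pi1 ρ)
    simp only [sub_zero, zero_div, zero_add] at this
    refine Tendsto.congr (fun n => ?_) this
    show _ = (F^[n] x) 1
    linarith [hsum n]
  · have := ((hZ.add hY).div_const (-2)).add_const (pi2 ρ)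
    simp only [add_zero, zero_div, zero_add] at this
    refine Tendsto.congr (fun n => ?_) this
    show _ = (F^[n] x) 2
    linarith [hsum n]
end

section
/- Assume 0 < φ < φ₁, where φ₁ := 2(1+ρ)(1+ρ²)/(3(1+ρ)(1+ρ²) + (1−ρ)S). Then for every x = (x₀, x₁, x₂) ∈ Δ with x₀ < π₀, the following are equivalent: (a) for every integer n ≥ 1, (x·P_B^n)₀ < π₀; (b) (1 − S/(1+ρ²))(x₀ − π₀) + 2(x₁ − π₁) ≥ 0. -/
open Matrix Filter

lemma aux_step (ρ φ s : ℝ) (hρ0 : 0 < ρ)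
    (hs : s^2 * (1+ρ^2) = 1 + 4*ρ + ρ^2) (y : Fin 3 → ℝ) (hy : y 0 + y 1 + y 2 = 1) :
    (y ᵥ* PB ρ φ) 0 + (y ᵥ* PB ρ φ) 1 + (y ᵥ* PB ρ φ) 2 = 1 ∧
    (1 - s) * ((y ᵥ* PB ρ φ) 0 - pi0 ρ) + 2 * ((y ᵥ* PB ρ φ) 1 - pi1 ρ)
      = (1 - φ + φ * (-(1/2) + (1-ρ)/(1+ρ) * s / 2)) *
        ((1 - s) * (y 0 - pi0 ρ) + 2 * (y 1 - pi1 ρ)) := by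
  have h2 : y 2 = 1 - y 0 - y 1 := by linarith
  have h1 : (1:ℝ) + ρ ≠ 0 := by positivity
  have h3 : (1:ℝ) + ρ^2 ≠ 0 := by positivity
  have h4 : (1:ℝ) + ρ + ρ^2 ≠ 0 := by positivity
  have e0 : (y ᵥ* PB ρ φ) 0 = y 0 * (1-φ) + φ * (y 1 * (ρ/(1+ρ)) + y 2 * (1/(1+ρ))) := by
    simp [PB, PBo, Matrix.vecMul, dotProduct, Fin.sum_univ_three, Matrix.one_apply]
    field_simp; ring
  have e1 : (y ᵥ* PB ρ φ) 1 = y 1 * (1-φ) + φ * (y 0 * (ρ^2/(1+ρ^2)) + y 2 * (ρ/(1+ρ))) := by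
    simp [PB, PBo, Matrix.vecMul, dotProduct, Fin.sum_univ_three, Matrix.one_apply]
    field_simp; ring
  have e2 : (y ᵥ* PB ρ φ) 2 = y 2 * (1-φ) + φ * (y 0 * (1/(1+ρ^2)) + y 1 * (1/(1+ρ))) := by
    simp [PB, PBo, Matrix.vecMul, dotProduct, Fin.sum_univ_three, Matrix.one_apply]
    field_simp; ring
  rw [e0, e1, e2, h2]
  constructor
  · field_simp; ring
  · have hs' : s^2 = 1 + 4*ρ/(1+ρ^2) := by field_simp; linarith
    have key : ∀ u v : ℝ, (1 - s) * (-(1/(1+ρ)) * u - (1-ρ)/(1+ρ) * v)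
        + 2 * ((ρ^2/(1+ρ^2) - ρ/(1+ρ)) * u - ρ/(1+ρ) * v)
        = (-(1/2) + (1-ρ)/(1+ρ) * s / 2) * ((1-s)*u + 2*v) := by
      intro u v
      have : (-(1/2) + (1-ρ)/(1+ρ) * s / 2) * ((1-s)*u + 2*v)
        = (-(1/2) + s/2) * u - v + (1-ρ)/(1+ρ)/2 * (s - s^2) * u + (1-ρ)/(1+ρ) * s * v := by ring
      rw [this, hs']
      field_simp
      ring
    have k := key (y 0 - pi0 ρ) (y 1 - pi1 ρ)
    have f0 : y 1 * (ρ/(1+ρ)) + (1 - y 0 - y 1) * (1/(1+ρ)) - pi0 ρ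
       = -(1/(1+ρ)) * (y 0 - pi0 ρ) - (1-ρ)/(1+ρ) * (y 1 - pi1 ρ) := by
      unfold pi0 pi1; field_simp; ring
    have f1 : y 0 * (ρ^2/(1+ρ^2)) + (1 - y 0 - y 1) * (ρ/(1+ρ)) - pi1 ρ
       = (ρ^2/(1+ρ^2) - ρ/(1+ρ)) * (y 0 - pi0 ρ) - ρ/(1+ρ) * (y 1 - pi1 ρ) := by
      unfold pi0 pi1; field_simp; ring
    rw [← f0, ← f1] at k
    linear_combination φ * k

lemma aux_pow (ρ φ s : ℝ) (hρ0 : 0 < ρ)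
    (hs : s^2 * (1+ρ^2) = 1 + 4*ρ + ρ^2) (y : Fin 3 → ℝ) (hy : y 0 + y 1 + y 2 = 1) (n : ℕ) :
    (y ᵥ* PB ρ φ ^ n) 0 + (y ᵥ* PB ρ φ ^ n) 1 + (y ᵥ* PB ρ φ ^ n) 2 = 1 ∧
    (1 - s) * ((y ᵥ* PB ρ φ ^ n) 0 - pi0 ρ) + 2 * ((y ᵥ* PB ρ φ ^ n) 1 - pi1 ρ)
      = (1 - φ + φ * (-(1/2) + (1-ρ)/(1+ρ) * s / 2)) ^ n *
        ((1 - s) * (y 0 - pi0 ρ) + 2 * (y 1 - pi1 ρ)) := by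
  induction n with
  | zero => simpa using hy
  | succ n ih =>
    have h := aux_step ρ φ s hρ0 hs _ ih.1
    rw [pow_succ (PB ρ φ), ← Matrix.vecMul_vecMul]
    refine ⟨h.1, ?_⟩
    rw [h.2, ih.2]
    ring

theorem stmt_8 (ρ φ : ℝ) (hρ0 : 0 < ρ) (hρ1 : ρ < 1) (hφ0 : 0 < φ)
    (hφ1 : φ < 2*(1+ρ)*(1+ρ^2) / (3*(1+ρ)*(1+ρ^2) + (1-ρ) * Sv ρ))
    (x : Fin 3 → ℝ) (hx : x ∈ Δ) (hx0 : x 0 < pi0 ρ) :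
    (∀ n : ℕ, 1 ≤ n → (x ᵥ* ((PB ρ φ) ^ n)) 0 < pi0 ρ) ↔
    0 ≤ (1 - Sv ρ / (1 + ρ^2)) * (x 0 - pi0 ρ) + 2 * (x 1 - pi1 ρ) := by
  have hS : 0 < Sv ρ := Real.sqrt_pos.mpr (by positivity)
  have hS2 : Sv ρ ^ 2 = (1 + ρ^2) * (1 + 4*ρ + ρ^2) := Real.sq_sqrt (by positivity)
  obtain ⟨s, hsd⟩ : ∃ s, s = Sv ρ / (1 + ρ^2) := ⟨_, rfl⟩
  have hq : (0:ℝ) < 1 + ρ^2 := by positivity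
  have hSs : Sv ρ = s * (1 + ρ^2) := by rw [hsd]; field_simp
  have hs0 : 0 < s := by rw [hsd]; positivity
  have hs : s^2 * (1+ρ^2) = 1 + 4*ρ + ρ^2 := by
    rw [hsd, div_pow, hS2]; field_simp
  obtain ⟨c, hc⟩ : ∃ c, c = (1-ρ)/(1+ρ) := ⟨_, rfl⟩
  have h1ρ : 0 < 1 - ρ := by linarith
  have hc0 : 0 < c := by rw [hc]; positivity
  have hp := fun n => (aux_pow ρ φ s hρ0 hs x hx.2 n).2
  have hm := fun n => (aux_pow ρ φ (-s) hρ0 (by rw [neg_sq]; exact hs) x hx.2 n).2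
  rw [← hsd]
  rw [← hc] at hp hm
  have hden : φ * (3 + c * s) < 2 := by
    have : 2*(1+ρ)*(1+ρ^2) / (3*(1+ρ)*(1+ρ^2) + (1-ρ) * Sv ρ) = 2 / (3 + c * s) := by
      rw [hSs, hc]
      have : 0 < 3 + (1-ρ)/(1+ρ) * s := by positivity
      field_simp
    rw [this, lt_div_iff₀ (by positivity)] at hφ1
    exact hφ1
  set E1 := 1 - φ + φ * (-(1/2) + c * s / 2) with hE1
  set E2 := 1 - φ + φ * (-(1/2) + c * (-s) / 2) with hE2
  set A := (1 - s) * (x 0 - pi0 ρ) + 2 * (x 1 - pi1 ρ) with hA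
  set B := (1 - -s) * (x 0 - pi0 ρ) + 2 * (x 1 - pi1 ρ) with hB
  have hE2p : 0 < E2 := by rw [hE2]; linarith
  have hE12 : E2 < E1 := by
    have : 0 < φ * (c * s) := by positivity
    rw [hE1, hE2]; linarith
  have hBA : B < A := by
    have := mul_pos hs0 (sub_pos.mpr hx0)
    rw [hA, hB]; linarith
  have hu : ∀ n, 2 * s * ((x ᵥ* PB ρ φ ^ n) 0 - pi0 ρ) = E2^n * B - E1^n * A := by
    intro n; rw [← hp, ← hm]; ring
  have hiff : ∀ n, (x ᵥ* PB ρ φ ^ n) 0 < pi0 ρ ↔ E2^n * B < E1^n * A := by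
    intro n
    rw [← sub_neg, ← sub_neg (a := E2^n * B), ← hu n]
    constructor
    · intro h; exact mul_neg_of_pos_of_neg (by positivity) h
    · intro h; exact (pos_iff_neg_of_mul_neg h).mp (by positivity)
  simp only [hiff]
  constructor
  · intro h
    by_contra! hA0
    have hr : E2 / E1 < 1 := (div_lt_one (hE2p.trans hE12)).mpr hE12
    have hr0 : 0 ≤ E2 / E1 := by have := hE2p.trans hE12; positivity
    obtain ⟨n, hn⟩ := exists_pow_lt_of_lt_one (div_pos_of_neg_of_neg hA0 (hBA.trans hA0)) hr
    have hn' : (E2/E1)^(n+1) < A / B :=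
      lt_of_le_of_lt (pow_le_pow_of_le_one hr0 hr.le (Nat.le_succ n)) hn
    have hk := h (n+1) (by omega)
    rw [lt_div_iff_of_neg (hBA.trans hA0), div_pow, div_mul_eq_mul_div,
      lt_div_iff₀ (pow_pos (hE2p.trans hE12) _)] at hn'
    linarith
  · intro hA0 n _
    calc E2^n * B < E2^n * A := mul_lt_mul_of_pos_left hBA (pow_pos hE2p n)
      _ ≤ E1^n * A := mul_le_mul_of_nonneg_right (pow_le_pow_left₀ hE2p.le hE12.le n) hA0
end

section
/- Assume φ = 2/3. Then for every x = (x₀, x₁, x₂) ∈ Δ with x₀ < π₀, the following are equivalent: (a) for every integer n ≥ 1, (x·P_B^n)₀ < π₀; (b) (x₀ − π₀) + 2(x₁ − π₁) > 0. -/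
open Matrix Filter

/-- One step of the dynamics at `φ = 2/3`, in coordinates centred at the stationary law. -/
lemma step_aux (ρ : ℝ) (hρ0 : 0 < ρ) (y : Fin 3 → ℝ) (hy : y 0 + y 1 + y 2 = 1) :
    (y ᵥ* PB ρ (2/3)) 0 + (y ᵥ* PB ρ (2/3)) 1 + (y ᵥ* PB ρ (2/3)) 2 = 1 ∧
    (y ᵥ* PB ρ (2/3)) 0 - pi0 ρ
      = -((1 - ρ) / (3 * (1 + ρ)) * ((y 0 - pi0 ρ) + 2 * (y 1 - pi1 ρ))) ∧
    ((y ᵥ* PB ρ (2/3)) 0 - pi0 ρ) + 2 * ((y ᵥ* PB ρ (2/3)) 1 - pi1 ρ)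
      = (1 - ρ) * (1 + 4 * ρ + ρ^2) / (3 * (1 + ρ) * (1 + ρ^2)) * (pi0 ρ - y 0) := by
  have h1 : 1 + ρ ≠ 0 := by positivity
  have h2 : 1 + ρ^2 ≠ 0 := by positivity
  have h3 : 1 + ρ + ρ^2 ≠ 0 := by positivity
  have h4 : y 2 = 1 - y 0 - y 1 := by linarith
  simp [PB, PBo, pi0, pi1, Matrix.vecMul, dotProduct, Fin.sum_univ_three, Matrix.one_apply, h4]
  refine ⟨?_, ?_, ?_⟩ <;> field_simp <;> ring

theorem stmt_9 (ρ φ : ℝ) (hρ0 : 0 < ρ) (hρ1 : ρ < 1) (hφ : φ = 2/3)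
    (x : Fin 3 → ℝ) (hx : x ∈ Δ) (hx0 : x 0 < pi0 ρ) :
    (∀ n : ℕ, 1 ≤ n → (x ᵥ* ((PB ρ φ) ^ n)) 0 < pi0 ρ) ↔
    0 < (x 0 - pi0 ρ) + 2 * (x 1 - pi1 ρ) := by
  subst hφ
  constructor
  · intro h
    have h1 := h 1 le_rfl
    rw [pow_one] at h1
    obtain ⟨-, h2, -⟩ := step_aux ρ hρ0 x hx.2
    have hk : 0 < (1 - ρ) / (3 * (1 + ρ)) := div_pos (by linarith) (by linarith)
    by_contra hc
    nlinarith [mul_nonneg hk.le (sub_nonneg.2 (not_lt.1 hc))]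
  · intro h n _
    suffices H : ((x ᵥ* ((PB ρ (2/3)) ^ n)) 0 + (x ᵥ* ((PB ρ (2/3)) ^ n)) 1
        + (x ᵥ* ((PB ρ (2/3)) ^ n)) 2 = 1) ∧ (x ᵥ* ((PB ρ (2/3)) ^ n)) 0 < pi0 ρ ∧
        0 < ((x ᵥ* ((PB ρ (2/3)) ^ n)) 0 - pi0 ρ) + 2 * ((x ᵥ* ((PB ρ (2/3)) ^ n)) 1 - pi1 ρ) from
      H.2.1
    clear * - hρ0 hρ1 hx hx0 h
    induction n with
    | zero => simpa using ⟨hx.2, hx0, h⟩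
    | succ k ih =>
      rw [pow_succ, ← Matrix.vecMul_vecMul]
      obtain ⟨i1, i2, i3⟩ := ih
      obtain ⟨s1, s2, s3⟩ := step_aux ρ hρ0 _ i1
      have hr : 0 < 1 - ρ := by linarith
      refine ⟨s1, ?_, ?_⟩
      · have : 0 < (1 - ρ) / (3 * (1 + ρ)) := by positivity
        have := mul_pos this i3
        linarith
      · rw [s3]
        have := sub_pos.2 i2
        positivity
end

section
/- Let x = (x₀, x₁, x₂) ∈ Δ satisfy x₀ < π₀ and x₁ < π₁, and set (y₀, y₁, y₂) := x·P_B. Then y₀ > x₀ and y₁ > x₁. (That is, while game B is played in this region, the trajectory moves strictly in the positive x₀ and x₁ directions.) -/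
open Matrix Filter

theorem stmt_11 (ρ φ : ℝ) (hρ0 : 0 < ρ) (hρ1 : ρ < 1) (hφ0 : 0 < φ) (hφ1 : φ ≤ 1)
    (x : Fin 3 → ℝ) (hx : x ∈ Δ) (hx0 : x 0 < pi0 ρ) (hx1 : x 1 < pi1 ρ) :
    x 0 < (x ᵥ* PB ρ φ) 0 ∧ x 1 < (x ᵥ* PB ρ φ) 1 := by
  obtain ⟨_, hs⟩ := hx
  have h2 : x 2 = 1 - x 0 - x 1 := by linarith
  have hA : (0:ℝ) < 1 + ρ := by linarith
  have hB : (0:ℝ) < 1 + ρ^2 := by positivity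
  have hC : (0:ℝ) < 1 + ρ + ρ^2 := by positivity
  have hD : (0:ℝ) < 1 - ρ := by linarith
  have hu : 0 < pi0 ρ - x 0 := by linarith
  have hv : 0 < pi1 ρ - x 1 := by linarith
  have e0 : (x ᵥ* PB ρ φ) 0 - x 0
      = φ / (1 + ρ) * ((2 + ρ) * (pi0 ρ - x 0) + (1 - ρ) * (pi1 ρ - x 1)) := by
    simp [PB, PBo, Matrix.vecMul, dotProduct, Fin.sum_univ_three, h2, pi0, pi1]
    field_simp
    ring
  have e1 : (x ᵥ* PB ρ φ) 1 - x 1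
      = φ / (1 + ρ) * (ρ * (1 - ρ) / (1 + ρ^2) * (pi0 ρ - x 0)
          + (1 + 2 * ρ) * (pi1 ρ - x 1)) := by
    simp [PB, PBo, Matrix.vecMul, dotProduct, Fin.sum_univ_three, h2, pi0, pi1]
    field_simp
    ring
  constructor
  · have : 0 < (x ᵥ* PB ρ φ) 0 - x 0 := by rw [e0]; positivity
    linarith
  · have : 0 < (x ᵥ* PB ρ φ) 1 - x 1 := by rw [e1]; positivity
    linarith
end

section
/- Assume 2/3 < φ ≤ 1 and let n ≥ 1 be an integer. Then Dₙ > 0, and every probability row vector v (i.e., v ∈ Δ) satisfying v·(P_A·P_B^n) = v has first coordinate v₀ = π₀ + Eₙ/Dₙ. -/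
open Matrix Filter

/-- Right eigenvectors of the game B matrix for the nontrivial eigenvalues. -/
noncomputable def wvec (ρ μ : ℝ) : Fin 3 → ℝ :=
  ![(1+ρ)*(-(1+ρ^2)+(1+μ)*(1+ρ)^2),
    ρ*(2*(1+ρ+ρ^2)) - (2+μ)*(1+ρ^2)*(1+ρ),
    2*(1+ρ+ρ^2) - (2+μ)*(1+ρ^2)*(1+ρ)]

lemma PBo_wvec (ρ μ : ℝ) (hρ0 : 0 < ρ)
    (hμ : (μ^2+μ)*(1+ρ)^2*(1+ρ^2) + 2*ρ^2 = 0) :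
    PBo ρ *ᵥ wvec ρ μ = μ • wvec ρ μ := by
  have h1 : (1+ρ) ≠ 0 := by positivity
  have h2 : (1+ρ^2) ≠ 0 := by positivity
  have h4 : (2*ρ^2) = -((μ^2+μ)*(1+ρ)^2*(1+ρ^2)) := by linarith
  ext i
  fin_cases i
  · simp [PBo, wvec, Matrix.mulVec, dotProduct, Fin.sum_univ_three]
    field_simp
    linear_combination (-(1+ρ)) * hμ
  · simp [PBo, wvec, Matrix.mulVec, dotProduct, Fin.sum_univ_three]
    field_simp
    linear_combination hμ
  · simp [PBo, wvec, Matrix.mulVec, dotProduct, Fin.sum_univ_three]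
    field_simp
    linear_combination hμ

lemma PB_pow_wvec (ρ φ μ : ℝ) (hρ0 : 0 < ρ)
    (hμ : (μ^2+μ)*(1+ρ)^2*(1+ρ^2) + 2*ρ^2 = 0) (n : ℕ) :
    (PB ρ φ)^n *ᵥ wvec ρ μ = (1 - φ + φ*μ)^n • wvec ρ μ := by
  induction n with
  | zero => simp
  | succ k ih =>
    have h : PB ρ φ *ᵥ wvec ρ μ = (1 - φ + φ*μ) • wvec ρ μ := by
      rw [PB, Matrix.add_mulVec, Matrix.smul_mulVec, Matrix.smul_mulVec, PBo_wvec ρ μ hρ0 hμ,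
        Matrix.one_mulVec, smul_smul, add_smul]
    rw [pow_succ, ← Matrix.mulVec_mulVec, h, Matrix.mulVec_smul, ih, smul_smul, pow_succ,
      mul_comm]

lemma key_dot (ρ φ μ : ℝ) (hρ0 : 0 < ρ)
    (hμ : (μ^2+μ)*(1+ρ)^2*(1+ρ^2) + 2*ρ^2 = 0) (n : ℕ) (v : Fin 3 → ℝ)
    (hs : v 0 + v 1 + v 2 = 1) (hv : v ᵥ* (PA φ * (PB ρ φ) ^ n) = v) :
    (v ⬝ᵥ wvec ρ μ) * (2 + (1 - φ + φ*μ)^n * (3*φ-2))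
      = - φ * (1 - φ + φ*μ)^n * ((1+ρ)*(1-ρ)^2*(2+μ)) := by
  have h : v ⬝ᵥ wvec ρ μ = (1 - φ + φ*μ)^n * (v ⬝ᵥ (PA φ *ᵥ wvec ρ μ)) := by
    conv_lhs => rw [← hv]
    rw [← Matrix.dotProduct_mulVec, ← Matrix.mulVec_mulVec, PB_pow_wvec ρ φ μ hρ0 hμ,
      Matrix.mulVec_smul, dotProduct_smul, smul_eq_mul]
  have h2 : 2 * (v ⬝ᵥ (PA φ *ᵥ wvec ρ μ))
      = -(3*φ-2) * (v ⬝ᵥ wvec ρ μ) - φ * ((1+ρ)*(1-ρ)^2*(2+μ)) := by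
    have hv0 : v 0 = 1 - v 1 - v 2 := by linarith
    simp [PA, PAo, wvec, Matrix.mulVec, dotProduct, Fin.sum_univ_three, Matrix.one_apply]
    rw [hv0]
    ring
  linear_combination 2 * h + (1 - φ + φ*μ)^n * h2

lemma two_add_pos (φ e : ℝ) (hφ0 : 2/3 < φ) (hφ1 : φ ≤ 1) (he : |e| ≤ 1) (n : ℕ) :
    0 < 2 + e^n * (3*φ-2) := by
  have h1 : |e^n| ≤ 1 := by rw [abs_pow]; exact pow_le_one₀ (abs_nonneg _) he
  have := abs_le.mp h1
  nlinarith

theorem stmt_12 (ρ φ : ℝ) (hρ0 : 0 < ρ) (hρ1 : ρ < 1) (hφ0 : 2/3 < φ) (hφ1 : φ ≤ 1)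
    (n : ℕ) (hn : 1 ≤ n) :
    0 < Dn ρ φ n ∧
    ∀ v : Fin 3 → ℝ, v ∈ Δ → v ᵥ* (PA φ * (PB ρ φ) ^ n) = v →
      v 0 = pi0 ρ + Emn ρ φ n n / Dn ρ φ n := by
  have hS : 0 < Sv ρ := Real.sqrt_pos.mpr (by positivity)
  have hS2 : Sv ρ ^ 2 = (1 + ρ^2) * (1 + 4*ρ + ρ^2) := Real.sq_sqrt (by positivity)
  obtain ⟨T, hT⟩ : ∃ T, T = (1 - ρ) * Sv ρ / (2 * (1 + ρ) * (1 + ρ^2)) := ⟨_, rfl⟩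
  have h1 : (1+ρ) ≠ 0 := by positivity
  have h2 : (1+ρ^2) ≠ 0 := by positivity
  have hTS : 2 * (1+ρ) * (1+ρ^2) * T = (1-ρ) * Sv ρ := by
    rw [hT]; field_simp
  have hT0 : 0 < T := by
    rw [hT]; have : 0 < 1 - ρ := by linarith
    positivity
  have hT2 : 4 * (1+ρ)^2 * (1+ρ^2) * T^2 = (1-ρ)^2 * (1+4*ρ+ρ^2) := by
    apply mul_left_cancel₀ h2
    linear_combination (2 * (1+ρ) * (1+ρ^2) * T + (1-ρ) * Sv ρ) * hTS + (1-ρ)^2 * hS2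
  have hT1 : T ≤ 1/2 := by
    by_contra hc
    push Not at hc
    have : 1/4 < T^2 := by nlinarith
    have hp : 0 < (1+ρ)^2 * (1+ρ^2) := by positivity
    nlinarith [mul_lt_mul_of_pos_left this hp, sq_nonneg ρ]
  have he1 : e1 ρ φ = 1 - φ + φ * (-(1/2) + T) := by rw [e1, hT]
  have he2 : e2 ρ φ = 1 - φ + φ * (-(1/2) - T) := by rw [e2, hT]
  have hA1 := two_add_pos φ (e1 ρ φ) hφ0 hφ1
    (by rw [he1, abs_le]; constructor <;> nlinarith) n
  have hA2 := two_add_pos φ (e2 ρ φ) hφ0 hφ1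
    (by rw [he2, abs_le]; constructor <;> nlinarith) n
  have hD : 0 < Dn ρ φ n := by unfold Dn; positivity
  refine ⟨hD, fun v hv hfix => ?_⟩
  have k1 := key_dot ρ φ (-(1/2) + T) hρ0 (by linear_combination hT2 / 4) n v hv.2 hfix
  have k2 := key_dot ρ φ (-(1/2) - T) hρ0 (by linear_combination hT2 / 4) n v hv.2 hfix
  rw [← he1] at k1
  rw [← he2] at k2
  have hdiff : v ⬝ᵥ wvec ρ (-(1/2) + T) - v ⬝ᵥ wvec ρ (-(1/2) - T)
      = 2 * T * (1+ρ) * (v 0 * (2 * (1+ρ+ρ^2)) - (1+ρ^2)) := by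
    have hv0 : v 2 = 1 - v 0 - v 1 := by linarith [hv.2]
    simp [wvec, dotProduct, Fin.sum_univ_three]
    rw [hv0]
    ring
  have hL : (1+ρ+ρ^2) ≠ 0 := by positivity
  unfold Emn pi0
  unfold Dn at hD ⊢
  generalize v ⬝ᵥ wvec ρ (-(1/2) + T) = x at *
  generalize v ⬝ᵥ wvec ρ (-(1/2) - T) = y at *
  generalize (e1 ρ φ)^n = a at *
  generalize (e2 ρ φ)^n = b at *
  rw [← hTS]
  have hr : (1-ρ) ≠ 0 := by linarith
  generalize 2 + a * (3*φ-2) = A at *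
  generalize 2 + b * (3*φ-2) = B at *
  have hA' := hA1.ne'
  have hB' := hA2.ne'
  have hS' := hS.ne'
  have hT' : 2 * T * (1+ρ) ≠ 0 := by positivity
  have main : (v 0 * (2 * (1+ρ+ρ^2)) - (1+ρ^2)) * (A * B * Sv ρ) =
      φ * (1 - ρ) / 2 *
          (b * A * (3 * (1 + ρ) * (1 + ρ ^ 2) - 2 * (1 + ρ) * (1 + ρ ^ 2) * T) -
            a * B * (3 * (1 + ρ) * (1 + ρ ^ 2) + 2 * (1 + ρ) * (1 + ρ ^ 2) * T)) := by
    apply mul_left_cancel₀ hT'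
    linear_combination (-(A * B * Sv ρ)) * hdiff + B * Sv ρ * k1 - A * Sv ρ * k2
      - φ * (1-ρ) * (1+ρ) * (b * A * (3/2 - T) - a * B * (3/2 + T)) * hTS
  rw [← main]
  field_simp
  ring
end

section
/- Assume 2/3 < φ ≤ 1, let n ≥ 1 be an integer, and let v be a probability row vector (v ∈ Δ) satisfying v·(P_A·P_B^n) = v. Then for every integer m ≥ 0, the first coordinate of v·P_A·P_B^m equals π₀ + E_{n,m}/Dₙ. -/
open Matrix Filter

/-- Up to a scalar, right eigenvectors of `PB` for the eigenvalue `1 - φ + φ (-1/2 + q)`. -/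
noncomputable def rvec (ρ q : ℝ) : Fin 3 → ℝ :=
  ![-pi0 ρ + (1/2 + q) * (1 - pi0 ρ),
    ρ/(1+ρ) - pi0 ρ - (1/2 + q) * pi0 ρ,
    1/(1+ρ) - pi0 ρ - (1/2 + q) * pi0 ρ]

lemma rvec_eig (ρ φ q : ℝ) (h0 : 0 < ρ)
    (hq : q^2 = (1-ρ)^2*(1+4*ρ+ρ^2)/(4*(1+ρ)^2*(1+ρ^2))) :
    PB ρ φ *ᵥ rvec ρ q = (1 - φ + φ * (-(1/2) + q)) • rvec ρ q := by
  have a : 1 + ρ ≠ 0 := by positivity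
  have b : 1 + ρ^2 ≠ 0 := by positivity
  have c : 1 + ρ + ρ^2 ≠ 0 := by positivity
  have hq2 : q^2 * (4*(1+ρ)^2*(1+ρ^2)) = (1-ρ)^2*(1+4*ρ+ρ^2) := by
    rw [hq]; field_simp
  have key : PBo ρ *ᵥ rvec ρ q = (-(1/2) + q) • rvec ρ q := by
    ext i
    fin_cases i
    · simp [PBo, rvec, pi0, Matrix.mulVec, dotProduct, Fin.sum_univ_three]
      field_simp
      linear_combination (-(1+ρ)) * hq2
    · simp [PBo, rvec, pi0, Matrix.mulVec, dotProduct, Fin.sum_univ_three]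
      field_simp
      linear_combination hq2
    · simp [PBo, rvec, pi0, Matrix.mulVec, dotProduct, Fin.sum_univ_three]
      field_simp
      linear_combination hq2
  rw [PB, Matrix.add_mulVec, Matrix.smul_mulVec, Matrix.smul_mulVec, key, Matrix.one_mulVec,
    smul_smul, ← add_smul]

lemma pow_eig (M : Matrix (Fin 3) (Fin 3) ℝ) (r : Fin 3 → ℝ) (e : ℝ) (h : M *ᵥ r = e • r)
    (m : ℕ) : (M ^ m) *ᵥ r = e ^ m • r := by
  induction m with
  | zero => simp
  | succ k ih =>
    rw [pow_succ, ← Matrix.mulVec_mulVec, h, Matrix.mulVec_smul, ih, smul_smul, pow_succ, mul_comm]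

lemma PA_dot (φ : ℝ) (v r : Fin 3 → ℝ) (hs : v 0 + v 1 + v 2 = 1) :
    (v ᵥ* PA φ) ⬝ᵥ r = -((3*φ-2)/2) * (v ⬝ᵥ r) + φ/2 * (r 0 + r 1 + r 2) := by
  simp [PA, PAo, Matrix.vecMul, dotProduct, Fin.sum_univ_three, Matrix.one_apply]
  linear_combination φ/2 * (r 0 + r 1 + r 2) * hs

lemma dot_val (ρ φ e : ℝ) (n m : ℕ) (v r : Fin 3 → ℝ) (hs : v 0 + v 1 + v 2 = 1)
    (h : PB ρ φ *ᵥ r = e • r) (hd : 2 + e^n * (3*φ-2) ≠ 0)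
    (hfix : v ᵥ* (PA φ * (PB ρ φ) ^ n) = v) :
    ((v ᵥ* PA φ) ᵥ* ((PB ρ φ) ^ m)) ⬝ᵥ r = e^m * (φ * (r 0 + r 1 + r 2) / (2 + e^n * (3*φ-2))) := by
  have hp : ∀ k, ((v ᵥ* PA φ) ᵥ* ((PB ρ φ) ^ k)) ⬝ᵥ r = e^k * ((v ᵥ* PA φ) ⬝ᵥ r) := by
    intro k
    rw [← Matrix.dotProduct_mulVec, pow_eig _ _ _ h, dotProduct_smul, smul_eq_mul]
  have h1 := hp n
  rw [Matrix.vecMul_vecMul, hfix] at h1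
  have h2 := PA_dot φ v r hs
  rw [hp, eq_div_of_mul_eq hd (a := (v ᵥ* PA φ) ⬝ᵥ r)]
  rw [h1] at h2
  linear_combination 2 * h2

lemma den_pos (φ l : ℝ) (n : ℕ) (hφ0 : 2/3 < φ) (hφ1 : φ ≤ 1) (h1 : -1 ≤ l) (h2 : l ≤ 1) :
    2 + (1 - φ + φ * l)^n * (3*φ-2) ≠ 0 := by
  have h : |(1 - φ + φ * l)^n| ≤ 1 := by
    rw [abs_pow]
    apply pow_le_one₀ (abs_nonneg _)
    rw [abs_le]
    constructor <;> nlinarith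
  have := abs_le.1 h
  nlinarith

lemma sum_one (ρ φ : ℝ) (n : ℕ) (v : Fin 3 → ℝ) (hs : v 0 + v 1 + v 2 = 1) (h0 : 0 < ρ) :
    (((v ᵥ* PA φ) ᵥ* ((PB ρ φ) ^ n)) ⬝ᵥ (fun _ => (1:ℝ))) = 1 := by
  have h : PB ρ φ *ᵥ (fun _ => (1:ℝ)) = (1:ℝ) • (fun _ => (1:ℝ)) := by
    ext i
    fin_cases i <;>
      simp [PB, PBo, Matrix.mulVec, dotProduct, Fin.sum_univ_three, Matrix.one_apply] <;> ring
  rw [← Matrix.dotProduct_mulVec, pow_eig _ _ _ h, dotProduct_smul, PA_dot _ _ _ hs]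
  simp [dotProduct, Fin.sum_univ_three, hs]
  ring

theorem stmt_13 (ρ φ : ℝ) (hρ0 : 0 < ρ) (hρ1 : ρ < 1) (hφ0 : 2/3 < φ) (hφ1 : φ ≤ 1)
    (n : ℕ) (hn : 1 ≤ n) (v : Fin 3 → ℝ) (hv : v ∈ Δ)
    (hfix : v ᵥ* (PA φ * (PB ρ φ) ^ n) = v) (m : ℕ) :
    ((v ᵥ* PA φ) ᵥ* ((PB ρ φ) ^ m)) 0 = pi0 ρ + Emn ρ φ n m / Dn ρ φ n := by
  have hs := hv.2
  have a : 1 + ρ ≠ 0 := by positivity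
  have b : 1 + ρ^2 ≠ 0 := by positivity
  have c : 1 + ρ + ρ^2 ≠ 0 := by positivity
  have d : 1 - ρ ≠ 0 := by linarith
  have d' : 0 < 1 - ρ := by linarith
  have hS : 0 < Sv ρ := Real.sqrt_pos.2 (by positivity)
  have hS2 : Sv ρ ^ 2 = (1 + ρ^2) * (1 + 4*ρ + ρ^2) := Real.sq_sqrt (by positivity)
  obtain ⟨q, hq⟩ : ∃ q, q = (1 - ρ) * Sv ρ / (2 * (1 + ρ) * (1 + ρ^2)) := ⟨_, rfl⟩
  have hq0 : 0 < q := by rw [hq]; positivity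
  have hq2 : q^2 = (1-ρ)^2*(1+4*ρ+ρ^2)/(4*(1+ρ)^2*(1+ρ^2)) := by
    rw [hq, div_pow, mul_pow, hS2]; field_simp; ring
  have hq1 : q ≤ 1/2 := by
    have : q^2 ≤ (1/2)^2 := by
      rw [hq2, div_le_iff₀ (by positivity)]
      nlinarith [sq_nonneg ρ]
    exact abs_le_of_sq_le_sq' this (by norm_num) |>.2
  have hSq : (1-ρ) * Sv ρ = 2 * q * (1+ρ)*(1+ρ^2) := by rw [hq]; field_simp
  have he1 : e1 ρ φ = 1 - φ + φ * (-(1/2) + q) := by rw [e1, hq]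
  have he2 : e2 ρ φ = 1 - φ + φ * (-(1/2) + -q) := by rw [e2, hq]; ring
  have r1 := rvec_eig ρ φ q hρ0 hq2
  have r2 := rvec_eig ρ φ (-q) hρ0 (by rw [neg_sq]; exact hq2)
  have n1 := den_pos φ (-(1/2) + q) n hφ0 hφ1 (by linarith) (by linarith)
  have n2 := den_pos φ (-(1/2) + -q) n hφ0 hφ1 (by linarith) (by linarith)
  have v1 := dot_val ρ φ _ n m v _ hs r1 n1 hfix
  have v2 := dot_val ρ φ _ n m v _ hs r2 n2 hfix
  have s1 := sum_one ρ φ m v hs hρ0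
  rw [← he1] at v1 n1
  rw [← he2] at v2 n2
  have sr : ∀ q, rvec ρ q 0 + rvec ρ q 1 + rvec ρ q 2
      = -((3/2 + q) * ((1-ρ)^2 / (2*(1+ρ+ρ^2)))) := by
    intro q
    simp [rvec, pi0]
    field_simp
    ring
  rw [sr] at v1 v2
  generalize (v ᵥ* PA φ) ᵥ* ((PB ρ φ) ^ m) = w at *
  have hw : w 0 = pi0 ρ + (w ⬝ᵥ rvec ρ q - w ⬝ᵥ rvec ρ (-q)) / (2*q) := by
    simp [dotProduct, Fin.sum_univ_three, rvec] at s1 ⊢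
    field_simp
    linear_combination (4*(1+ρ) * pi0 ρ * q) * s1
  rw [hw, v1, v2, Emn, Dn, hSq]
  have hS' : Sv ρ = 2 * q * (1+ρ)*(1+ρ^2) / (1-ρ) := by rw [← hSq]; field_simp
  rw [hS']
  have hq' := hq0.ne'
  generalize e1 ρ φ ^ n = x1 at *
  generalize e2 ρ φ ^ n = x2 at *
  generalize 2 + x1 * (3*φ-2) = y1 at *
  generalize 2 + x2 * (3*φ-2) = y2 at *
  congr 1
  field_simp
  ring
end

section
/- Assume 2/3 < φ < 3/4 and φ < φ₂, where φ₂ := 2(1+ρ)(1+ρ²)/(3(1+ρ)(1+ρ²) − (1−ρ)S), and let n ≥ 4 be an even integer. Then: (i) if E_{n−2} ≤ 0 then G_{n,n−2} < 0; (ii) E_{n,n−2} − E_{n−2} > 0 (in particular, if E_{n−2} = 0 then E_{n,n−2} > 0); (iii) if E_{n,n−2} ≥ 0 then H_{n,n−2} > 0; (iv) if H_{n,n−2} = 0 then G_{n+2,n} > 0. (These give the monotone ordering, from highest to lowest, of the curves G_{n,n−2} = 0, E_{n−2} = 0, E_{n,n−2} = 0, H_{n,n−2} = 0, G_{n+2,n}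 = 0 in the (ρ,φ)-parameter region.) -/
open Matrix Filter

/-- Multiplying both sides of a comparison of two-term differences. -/
lemma cross_lt {p q x y u v : ℝ} (hp : 0 < p) (hx : 0 < x) (hu : 0 < u) (h : p * x ≤ q * y) (hv : 0 < v)
    (hy : 0 < y) (hlt : u * y < v * x) : p * u < q * v := by
  have h1 : p * (u * y) < p * (v * x) := mul_lt_mul_of_pos_left hlt hp
  have h2 : v * (p * x) ≤ v * (q * y) := mul_le_mul_of_nonneg_left h hv.le
  have h3 : (p * u) * y < (q * v) * y := by nlinarith
  exact lt_of_mul_lt_mul_right h3 hy.le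

set_option maxHeartbeats 2000000 in
lemma key_core (a b c A B X Y X' Y' : ℝ) (ha : 0 < a) (hab : a < b) (hb : b < 1/2)
    (hc : c = b - a) (hA : 0 < A) (hB : 0 < B)
    (hX : X = a * X') (hY : Y = b * Y') (hX' : 0 < X') (hXY : X' ≤ Y') (hY1 : Y' ≤ 1)
    (hw : A * (1 - a^2) < B * (1 - b^2)) :
    (Y * (2 + X * c) * A - X * (2 + Y * c) * B ≤ 0 →
      Y * (4 - a^2*X^2 * c^2) * (2 - Y * c) * A
        - X * (4 - b^2*Y^2 * c^2) * (2 - X * c) * B < 0) ∧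
    (0 < (Y * (2 + X * a^2 * c) * A - X * (2 + Y * b^2 * c) * B)
        - (Y * (2 + X * c) * A - X * (2 + Y * c) * B)) ∧
    (0 ≤ Y * (2 + X * a^2 * c) * A - X * (2 + Y * b^2 * c) * B →
      0 < Y * (4 - a^2*X^2 * c^2) * (2 - Y * b^2 * c) * A
        - X * (4 - b^2*Y^2 * c^2) * (2 - X * a^2 * c) * B) ∧
    (Y * (4 - a^2*X^2 * c^2) * (2 - Y * b^2 * c) * A
        - X * (4 - b^2*Y^2 * c^2) * (2 - X * a^2 * c) * B = 0 →
      0 < Y * b^2 * (4 - a^6*X^2 * c^2) * (2 - Y * b^2 * c) * A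
        - X * a^2 * (4 - b^6*Y^2 * c^2) * (2 - X * a^2 * c) * B) := by
  have hbpos : 0 < b := ha.trans hab
  have hc0 : 0 < c := by linarith
  have hc1 : c < 1/2 := by linarith
  have hY' : 0 < Y' := hX'.trans_le hXY
  have hXp : 0 < X := by rw [hX]; positivity
  have hYp : 0 < Y := by rw [hY]; positivity
  have hXltY : X < Y := by
    rw [hX, hY]; nlinarith [mul_le_mul_of_nonneg_left hXY ha.le, mul_pos (sub_pos.2 hab) hY']
  have hYlt : Y < 1/2 := by
    rw [hY]; nlinarith
  have hb2 : b^2 < 1/4 := by nlinarith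
  have ha2 : a^2 < b^2 := by nlinarith
  have hc2 : c^2 < 1/4 := by nlinarith
  have hY2 : Y^2 < 1/4 := by nlinarith
  have hX2 : X^2 < Y^2 := by nlinarith
  -- auxiliary monotonicity
  have hmono : X^2 * (1 - a^2) < Y^2 * (1 - b^2) := by
    have h1 : a^2 * (1 - a^2) < b^2 * (1 - b^2) := by
      nlinarith [mul_pos (sub_pos.2 ha2) (show (0:ℝ) < 1 - a^2 - b^2 by linarith)]
    have h2 : X'^2 ≤ Y'^2 := by nlinarith
    have h3 : 0 < b^2 * (1 - b^2) := mul_pos (by positivity) (by linarith)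
    have h4 : X'^2 * (a^2 * (1 - a^2)) < X'^2 * (b^2 * (1 - b^2)) :=
      mul_lt_mul_of_pos_left h1 (by positivity)
    have h5 : X'^2 * (b^2 * (1 - b^2)) ≤ Y'^2 * (b^2 * (1 - b^2)) :=
      mul_le_mul_of_nonneg_right h2 h3.le
    rw [hX, hY]; nlinarith
  have hba : 0 < b^2 - a^2 := by linarith
  have small : ∀ p q : ℝ, 0 ≤ p → p < 1 → 0 ≤ q → q < 1 → p * q < 1 := by
    intro p q h1 h2 h3 h4; nlinarith
  have hXc : X * c < 1 := small _ _ hXp.le (by linarith) hc0.le (by linarith)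
  have hYc : Y * c < 1 := small _ _ hYp.le (by linarith) hc0.le (by linarith)
  have hXa : X * a^2 < 1 := small _ _ hXp.le (by linarith) (by positivity) (by linarith)
  have hYb : Y * b^2 < 1 := small _ _ hYp.le (by linarith) (by positivity) (by linarith)
  have hXac : X * a^2 * c < 1 := small _ _ (by positivity) hXa hc0.le (by linarith)
  have hYbc : Y * b^2 * c < 1 := small _ _ (by positivity) hYb hc0.le (by linarith)
  have haX : a^2 * X^2 < 1 := small _ _ (by positivity) (by linarith) (by positivity) (by linarith)
  have hbY : b^2 * Y^2 < 1 := small _ _ (by positivity) (by linarith) (by positivity) (by linarith)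
  have haXc : a^2 * X^2 * c^2 < 1 := small _ _ (by positivity) haX (by positivity) (by linarith)
  have hbYc : b^2 * Y^2 * c^2 < 1 := small _ _ (by positivity) hbY (by positivity) (by linarith)
  have hb4 : b^2 * b^2 < 1 := small _ _ (by positivity) (by linarith) (by positivity) (by linarith)
  have hb6 : b^6 * Y^2 * c^2 < 1 := by
    have := small (b^2*b^2) (b^2 * Y^2 * c^2) (by positivity) hb4 (by positivity) hbYc
    nlinarith
  have h66 : a^6 * X^2 * c^2 ≤ b^6 * Y^2 * c^2 := by gcongr
  refine ⟨?_, ?_, ?_, ?_⟩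
  · intro h
    have := cross_lt (p := Y * A) (q := X * B) (x := 2 + X * c) (y := 2 + Y * c)
      (u := (4 - a^2*X^2 * c^2) * (2 - Y * c)) (v := (4 - b^2*Y^2 * c^2) * (2 - X * c))
      (by positivity) (by positivity) (mul_pos (by linarith) (by linarith)) (by linarith)
      (mul_pos (by linarith) (by linarith)) (by positivity)
      (by
        have e1 : 0 < c^2 * (4 * (Y^2 * (1 - b^2) - X^2 * (1 - a^2))
            + c^2 * (X^2 * Y^2) * (b^2 - a^2)) := by
          have : 0 < c^2 * (X^2 * Y^2) * (b^2 - a^2) := by positivity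
          apply mul_pos (by positivity); linarith
        linarith [e1])
    linarith
  · have : 0 < c * X * Y * (B * (1 - b^2) - A * (1 - a^2)) :=
      mul_pos (by positivity) (by linarith)
    linarith [this]
  · intro h
    have := cross_lt (p := X * B) (q := Y * A) (x := 2 + Y * b^2 * c) (y := 2 + X * a^2 * c)
      (u := (4 - b^2*Y^2 * c^2) * (2 - X * a^2 * c))
      (v := (4 - a^2*X^2 * c^2) * (2 - Y * b^2 * c))
      (by positivity) (by positivity) (mul_pos (by linarith) (by linarith)) (by linarith)
      (mul_pos (by linarith) (by linarith)) (by positivity)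
      (by
        have e1 : 0 < c^2 * (4 * (b^2 * (Y^2 * (1 - b^2)) - a^2 * (X^2 * (1 - a^2)))
            + c^2 * (a^2 * b^2 * X^2 * Y^2) * (b^2 - a^2)) := by
          have h1 : 0 < c^2 * (a^2 * b^2 * X^2 * Y^2) * (b^2 - a^2) := by positivity
          have h2 : 0 < X^2 * (1 - a^2) := mul_pos (by positivity) (by linarith)
          have h3 : a^2 * (X^2 * (1 - a^2)) < b^2 * (Y^2 * (1 - b^2)) :=
            mul_lt_mul'' ha2 hmono (by positivity) h2.le
          apply mul_pos (by positivity); linarith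
        linarith [e1])
    linarith
  · intro h
    have := cross_lt (p := X * (2 - X * a^2 * c) * B) (q := Y * (2 - Y * b^2 * c) * A)
      (x := 4 - b^2*Y^2 * c^2) (y := 4 - a^2*X^2 * c^2)
      (u := a^2 * (4 - b^6*Y^2 * c^2)) (v := b^2 * (4 - a^6*X^2 * c^2))
      (mul_pos (mul_pos hXp (by linarith)) hB) (by linarith)
      (mul_pos (by positivity) (by linarith)) (by linarith)
      (mul_pos (by positivity) (by linarith)) (by linarith)
      (by
        have h1 : a^2 * (4 - a^2*X^2 * c^2) < b^2 * (4 - b^2*Y^2 * c^2) := by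
          have h2 : b^2 - a^2 = c * (a + b) := by rw [hc]; ring
          have h3 : b^2 * (b^2*Y^2*c^2) ≤ c * b := by
            have : b^2 * (b^2 * Y^2 * c^2) = (c * b) * (b * (b^2 * Y^2) * c) := by ring
            rw [this]
            have h5 := small b (b^2 * Y^2) hbpos.le (by linarith) (by positivity) hbY
            have h6 := small _ c (by positivity) h5 hc0.le (by linarith)
            nlinarith [mul_pos hc0 hbpos]
          have h4 : 0 < a^2 * (a^2*X^2*c^2) := by positivity
          nlinarith [mul_pos hc0 hbpos, mul_pos hc0 ha]
        have h7 : 0 < a^2 * (4 - a^2*X^2 * c^2) := mul_pos (by positivity) (by linarith)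
        have h8 : (4 - b^6*Y^2 * c^2) * (a^2 * (4 - a^2*X^2 * c^2))
            < (4 - a^6*X^2 * c^2) * (b^2 * (4 - b^2*Y^2 * c^2)) :=
          mul_lt_mul' (by linarith) h1 h7.le (by linarith)
        linarith)
    linarith

theorem stmt_16 (ρ φ : ℝ) (hρ0 : 0 < ρ) (hρ1 : ρ < 1) (hφ0 : 2/3 < φ) (hφ34 : φ < 3/4)
    (hφ2 : φ < 2*(1+ρ)*(1+ρ^2) / (3*(1+ρ)*(1+ρ^2) - (1-ρ) * Sv ρ))
    (n : ℕ) (hn : 4 ≤ n) (hne : Even n) :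
    (Emn ρ φ (n - 2) (n - 2) ≤ 0 → Gmn ρ φ n (n - 2) < 0) ∧
    (0 < Emn ρ φ n (n - 2) - Emn ρ φ (n - 2) (n - 2)) ∧
    (0 ≤ Emn ρ φ n (n - 2) → 0 < Hmn ρ φ n (n - 2)) ∧
    (Hmn ρ φ n (n - 2) = 0 → 0 < Gmn ρ φ (n + 2) n) := by
  obtain ⟨j, hj⟩ := hne
  obtain ⟨i, rfl⟩ : ∃ i, j = i + 2 := ⟨j - 2, by omega⟩
  obtain ⟨k, hk⟩ : ∃ k, k = 2 * (i + 1) := ⟨_, rfl⟩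
  obtain rfl : n = k + 2 := by omega
  have hke : Even k := ⟨i + 1, by omega⟩
  have hk1 : k = (2 * i + 1) + 1 := by omega
  set S := Sv ρ with hS
  set K := (1 + ρ) * (1 + ρ^2) with hK
  have hKp : 0 < K := by positivity
  have hrad : 0 < (1 + ρ^2) * (1 + 4*ρ + ρ^2) := by positivity
  have hSp : 0 < S := Real.sqrt_pos.2 hrad
  have hS2 : S^2 = (1 + ρ^2) * (1 + 4*ρ + ρ^2) := Real.sq_sqrt hrad.le
  set t := (1 - ρ) * S / K with ht
  have htp : 0 < t := div_pos (mul_pos (by linarith) hSp) hKp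
  have htK : (1 - ρ) * S = t * K := by rw [ht]; field_simp
  have ht1 : t < 1 := by
    rw [ht, div_lt_one hKp]
    apply lt_of_pow_lt_pow_left₀ 2 hKp.le
    rw [mul_pow, hS2, hK]
    have : 0 < (1 + ρ^2) * (8 * ρ^2) := by positivity
    linarith [this]
  have hA : 3*(1+ρ)*(1+ρ^2) - (1-ρ) * S = K * (3 - t) := by rw [htK, hK]; ring
  have hB : 3*(1+ρ)*(1+ρ^2) + (1-ρ) * S = K * (3 + t) := by rw [htK, hK]; ring
  have hφt : φ * (3 - t) < 2 := by
    have h0 : 0 < K * (3 - t) := mul_pos hKp (by linarith)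
    rw [hA, lt_div_iff₀ h0] at hφ2
    have h1 : K * (φ * (3 - t)) < K * 2 := by
      have : K * 2 = 2 * (1 + ρ) * (1 + ρ^2) := by rw [hK]; ring
      linarith
    exact lt_of_mul_lt_mul_left h1 hKp.le
  have hdiv : (1 - ρ) * S / (2 * (1 + ρ) * (1 + ρ^2)) = t / 2 := by
    have : 2 * (1 + ρ) * (1 + ρ^2) = K * 2 := by rw [hK]; ring
    rw [this, htK]; field_simp
  obtain ⟨a, ha⟩ : ∃ a, a = (φ * t - (3 * φ - 2)) / 2 := ⟨_, rfl⟩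
  obtain ⟨b, hb⟩ : ∃ b, b = (φ * t + (3 * φ - 2)) / 2 := ⟨_, rfl⟩
  have he1 : e1 ρ φ = a := by unfold e1; rw [← hS, hdiv, ha]; ring
  have he2 : e2 ρ φ = -b := by unfold e2; rw [← hS, hdiv, hb]; ring
  have hφp : 0 < φ := by linarith
  have hφt1 : φ * t < 3/4 := by nlinarith
  have hapos : 0 < a := by rw [ha]; linarith
  have hab : a < b := by rw [ha, hb]; linarith
  have hb2 : b < 1/2 := by rw [hb]; linarith
  have hbp : 0 < b := hapos.trans hab
  have hc : 3 * φ - 2 = b - a := by rw [ha, hb]; ring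
  have hw : K * (3 - t) * (1 - a^2) < K * (3 + t) * (1 - b^2) := by
    have e : (3 + t) * (1 - b^2) - (3 - t) * (1 - a^2)
        = t * (2 - 3 * (3 * φ - 2) * φ - ((φ * t)^2 + (3 * φ - 2)^2) / 2) := by
      rw [ha, hb]; ring
    have h1 : (φ * t)^2 < 9/16 := by nlinarith [mul_pos hφp htp]
    have h2 : (3 * φ - 2)^2 < 1/16 := by nlinarith
    have h3 : (3 * φ - 2) * φ < 3/16 := by nlinarith
    have h4 : 0 < (3 + t) * (1 - b^2) - (3 - t) * (1 - a^2) := by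
      rw [e]; exact mul_pos htp (by linarith)
    have h5 := mul_pos hKp h4
    linarith
  have key := key_core a b (3 * φ - 2) (K * (3 - t)) (K * (3 + t)) (a^k) (b^k)
    (a^(2 * i + 1)) (b^(2 * i + 1)) hapos hab hb2 hc (mul_pos hKp (by linarith))
    (mul_pos hKp (by linarith)) (by rw [hk1]; ring) (by rw [hk1]; ring) (by positivity)
    (by gcongr) (pow_le_one₀ hbp.le (by linarith)) hw
  have hφρ : 0 < φ * (1 - ρ) := mul_pos hφp (by linarith)
  have hbk : (-b)^k = b^k := hke.neg_pow b
  have n1 : k + 2 - 2 = k := by omega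
  have n2 : k + 2 - 1 = k + 1 := by omega
  have n3 : k + 2 + 2 - 2 = k + 2 := by omega
  have n4 : k + 2 + 2 - 1 = k + 3 := by omega
  have p1 : ∀ x : ℝ, x^(k+2) = x^k * x^2 := fun x => by ring
  have p2 : ∀ x : ℝ, x^(2*(k+1)) = x^2 * (x^k)^2 := fun x => by ring
  have p3 : ∀ x : ℝ, x^(2*(k+3)) = x^6 * (x^k)^2 := fun x => by ring
  have q2 : (-b)^2 = b^2 := by ring
  have q6 : (-b)^6 = b^6 := by ring
  unfold Emn Gmn Hmn
  rw [n1, n2, n3, n4, he1, he2, ← hS, hA, hB]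
  simp only [p1, p2, p3, hbk, q2, q6]
  obtain ⟨k1, k2, k3, k4⟩ := key
  have hφρ2 : 0 < φ * (1 - ρ) / 2 := by linarith
  refine ⟨fun h => ?_, ?_, fun h => ?_, fun h => ?_⟩
  · exact mul_neg_of_pos_of_neg hφρ (k1 (nonpos_of_mul_nonpos_right h hφρ2))
  · rw [← mul_sub]; exact mul_pos hφρ2 k2
  · exact mul_pos hφρ (k3 (nonneg_of_mul_nonneg_right h hφρ2))
  · exact mul_pos hφρ (k4 ((mul_eq_zero.1 h).resolve_left hφρ.ne'))
end
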